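/- Top rationality cannot be dropped from the characterization: there exists an SDR that satisfies top consistency (TC), top anonymity (TA), top neutrality (TN) and top monotonicity (TM) but is not Condorcet-consistent; a witness is C₅ defined by C₅(R) = A∖{x,y} if there exist distinct alternatives x,y with R = R^{x,y}, and C₅(R) = A otherwise. -/

import Mathlib

/-- A weak order on `A`: a complete (total) and transitive binary relation. -/
structure WeakOrd (A : Type*) where
  rel : A → A → Prop
  total : ∀ x y, rel x y ∨ rel y x
  trans : ∀ x y z, rel x y → rel y z → rel x z

namespace WeakOrd

variable {A : Type*}

/-- Strict preference. -/
def strict (r : WeakOrd A) (x y : A) : Prop := r.rel x y ∧ ¬ r.rel y x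

/-- Indifference. -/
def indiff (r : WeakOrd A) (x y : A) : Prop := r.rel x y ∧ r.rel y x

open Classical in
/-- The weak order obtained from `r` by moving `x` and `y` strictly above all other
alternatives, preserving the relative ranking of `x` and `y` and of the rest. -/
noncomputable def topShift (r : WeakOrd A) (x y : A) : WeakOrd A where
  rel a b :=
    if a = x ∨ a = y then (if b = x ∨ b = y then r.rel a b else True)
    else if b = x ∨ b = y then False else r.rel a b
  total := by
    intro a b
    by_cases ha : a = x ∨ a = y <;> by_cases hb : b = x ∨ b = y <;>
      simp [ha, hb, r.total a b]
  trans := by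
    intro a b c hab hbc
    by_cases ha : a = x ∨ a = y <;> by_cases hb : b = x ∨ b = y <;>
      by_cases hc : c = x ∨ c = y <;> simp_all <;>
      exact r.trans _ _ _ hab hbc

/-- Relabelling the alternatives of a weak order by a permutation `σ`:
`a` is weakly preferred to `b` in `σ(r)` iff `σ⁻¹ a` is weakly preferred to `σ⁻¹ b` in `r`. -/
def map (σ : Equiv.Perm A) (r : WeakOrd A) : WeakOrd A where
  rel a b := r.rel (σ.symm a) (σ.symm b)
  total := fun _ _ => r.total _ _
  trans := fun _ _ _ hab hbc => r.trans _ _ _ hab hbc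

end WeakOrd

/-- A (preference) profile: a weak order for each voter. -/
abbrev Profile (N A : Type*) := N → WeakOrd A

namespace Profile

variable {N A : Type*}

/-- The top-shift profile `R^{x,y}`. -/
noncomputable def topShift (R : Profile N A) (x y : A) : Profile N A :=
  fun i => (R i).topShift x y

/-- Relabelling alternatives in every voter's preference by a permutation `σ`. -/
def map (σ : Equiv.Perm A) (R : Profile N A) : Profile N A := fun i => (R i).map σ

end Profile

/-- `nwins R x y` is `n(x,y,R)`, the number of voters strictly preferring `x` to `y`. -/
noncomputable def nwins {N A : Type*} (R : Profile N A) (x y : A) : ℕ :=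
  Nat.card {i // (R i).strict x y}

/-- The set of Condorcet winners of `R`. -/
def CW {N A : Type*} (R : Profile N A) : Set A :=
  {x | ∀ y, y ≠ x → nwins R y x ≤ nwins R x y}

/-- Condorcet consistency of a social decision rule. -/
def CondorcetConsistent {N A : Type*} (C : Profile N A → Set A) : Prop :=
  ∀ R : Profile N A, (CW R).Nonempty → C R = CW R

/-- The nice set `N_C(R)`: alternatives selected each time they are top-shifted with any
other alternative. -/
def niceSet {N A : Type*} (C : Profile N A → Set A) (R : Profile N A) : Set A :=
  {x | ∀ y, y ≠ x → x ∈ C (R.topShift x y)}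

/-- Weak top consistency (WTC). -/
def WeakTopConsistency {N A : Type*} (C : Profile N A → Set A) : Prop :=
  ∀ R : Profile N A, niceSet C R ⊆ C R

/-- Top consistency (TC). -/
def TopConsistency {N A : Type*} (C : Profile N A → Set A) : Prop :=
  ∀ R : Profile N A, (niceSet C R).Nonempty → C R = niceSet C R

/-- A 2-profile: two alternatives are unanimously strictly preferred to all others. -/
def IsTwoProfile {N A : Type*} (R : Profile N A) : Prop :=
  ∃ x y : A, x ≠ y ∧
    ∀ z, z ≠ x → z ≠ y → ∀ i, (R i).strict x z ∧ (R i).strict y z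

/-- Top anonymity (TA). -/
def TopAnonymity {N A : Type*} (C : Profile N A → Set A) : Prop :=
  ∀ R : Profile N A, IsTwoProfile R → ∀ π : Equiv.Perm N, C (fun i => R (π i)) = C R

/-- Top neutrality (TN). -/
def TopNeutrality {N A : Type*} (C : Profile N A → Set A) : Prop :=
  ∀ R : Profile N A, IsTwoProfile R → ∀ σ : Equiv.Perm A, C (Profile.map σ R) = σ '' (C R)

/-- Top symmetry (TS): top anonymity and top neutrality. -/
def TopSymmetry {N A : Type*} (C : Profile N A → Set A) : Prop :=
  TopAnonymity C ∧ TopNeutrality C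

/-- `Improves R Q x z`, i.e. `R ▷^{x,z} Q`: `Q` is an additional support of `x`
against `z` from `R` to `Q`. -/
def Improves {N A : Type*} (R Q : Profile N A) (x z : A) : Prop :=
  (∀ i w, ((R i).strict x w → (Q i).strict x w) ∧ ((R i).indiff x w → (Q i).rel x w)) ∧
  ∃ i, (R i).rel z x ∧ (Q i).strict x z

/-- Top monotonicity (TM). -/
def TopMonotonicity {N A : Type*} (C : Profile N A → Set A) : Prop :=
  ∀ (R Q : Profile N A) (x y z : A), x ≠ y → z ≠ x →
    x ∈ C (R.topShift x y) → Improves R Q x z →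
    x ∈ C (Q.topShift x y) ∧ z ∉ C (Q.topShift x y)

/-- Top rationality (TR). -/
def TopRationality {N A : Type*} (C : Profile N A → Set A) : Prop :=
  ∀ (R : Profile N A) (x y : A), x ≠ y → (C (R.topShift x y) ∩ {x, y}).Nonempty

/-- Maskin monotonicity (MM). -/
def MaskinMonotonic {N A : Type*} (C : Profile N A → Set A) : Prop :=
  ∀ (R Q : Profile N A) (x : A), x ∈ C R →
    (∀ i y, ((R i).strict x y → (Q i).strict x y) ∧ ((R i).indiff x y → (Q i).rel x y)) →
    x ∈ C Q

open Classical in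
/-- The rule `C₅`: if `R` coincides with the top-shift profile `R^{x,y}` for some
pair of distinct alternatives `x, y`, select `A ∖ {x, y}`; otherwise select `A`. -/
noncomputable def C5 {N A : Type*} (R : Profile N A) : Set A :=
  if h : ∃ p : A × A, p.1 ≠ p.2 ∧ R = R.topShift p.1 p.2 then
    {h.choose.1, h.choose.2}ᶜ
  else Set.univ

namespace WeakOrd

variable {A : Type*}

theorem ext_rel {r s : WeakOrd A} (h : ∀ a b, r.rel a b ↔ s.rel a b) : r = s := by
  obtain ⟨r, _, _⟩ := r
  obtain ⟨s, _, _⟩ := s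
  have : r = s := funext fun a => funext fun b => propext (h a b)
  subst this
  rfl

theorem topShift_strict_left (r : WeakOrd A) {x y z : A} (hx : z ≠ x) (hy : z ≠ y) :
    (r.topShift x y).strict x z := by
  simp [strict, topShift, hx, hy]

theorem topShift_strict_right (r : WeakOrd A) {x y z : A} (hx : z ≠ x) (hy : z ≠ y) :
    (r.topShift x y).strict y z := by
  simp [strict, topShift, hx, hy]

theorem eq_topShift_iff (r : WeakOrd A) (x y : A) :
    r = r.topShift x y ↔ ∀ z, z ≠ x → z ≠ y → r.strict x z ∧ r.strict y z := by
  constructor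
  · intro h z hx hy
    rw [h]
    exact ⟨r.topShift_strict_left hx hy, r.topShift_strict_right hx hy⟩
  · intro h
    apply ext_rel
    intro a b
    by_cases ha : a = x ∨ a = y <;> by_cases hb : b = x ∨ b = y <;>
      simp only [topShift, ha, hb, if_true, if_false, iff_true, iff_false]
    · rw [not_or] at hb
      rcases ha with rfl | rfl
      exacts [(h b hb.1 hb.2).1.1, (h b hb.1 hb.2).2.1]
    · rw [not_or] at ha
      rcases hb with rfl | rfl
      exacts [(h a ha.1 ha.2).1.2, (h a ha.1 ha.2).2.2]

theorem map_strict (σ : Equiv.Perm A) (r : WeakOrd A) (x y : A) :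
    (r.map σ).strict x y ↔ r.strict (σ.symm x) (σ.symm y) := Iff.rfl

end WeakOrd

namespace Profile

variable {N A : Type*}

/-- Every voter strictly prefers both `x` and `y` to all other alternatives. -/
def IsTopPair (R : Profile N A) (x y : A) : Prop :=
  ∀ z, z ≠ x → z ≠ y → ∀ i, (R i).strict x z ∧ (R i).strict y z

theorem eq_topShift_iff (R : Profile N A) (x y : A) :
    R = R.topShift x y ↔ R.IsTopPair x y := by
  constructor
  · intro h z hx hy i
    exact ((R i).eq_topShift_iff x y).1 (congrFun h i) z hx hy
  · intro h
    funext i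
    exact ((R i).eq_topShift_iff x y).2 fun z hx hy => h z hx hy i

theorem isTopPair_topShift (R : Profile N A) (x y : A) : (R.topShift x y).IsTopPair x y :=
  fun _ hx hy i =>
    ⟨(R i).topShift_strict_left hx hy, (R i).topShift_strict_right hx hy⟩

theorem IsTopPair.comm {R : Profile N A} {x y : A} (h : R.IsTopPair x y) : R.IsTopPair y x :=
  fun z hy hx i => (h z hx hy i).symm

theorem IsTopPair.mem_of_isTopPair [Nonempty N] {R : Profile N A} {x y u v : A} (hxy : x ≠ y)
    (h : R.IsTopPair x y) (h' : R.IsTopPair u v) : u = x ∨ u = y := by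
  by_contra! hu
  obtain ⟨i⟩ := ‹Nonempty N›
  have above := h u hu.1 hu.2 i
  have hx : x = v := by
    by_contra hx
    exact above.1.2 (h' x hu.1.symm hx i).1.1
  have hy : y = v := by
    by_contra hy
    exact above.2.2 (h' y hu.2.symm hy i).1.1
  exact hxy (hx.trans hy.symm)

theorem IsTopPair.pair_eq [Nonempty N] {R : Profile N A} {x y u v : A} (hxy : x ≠ y)
    (huv : u ≠ v) (h : R.IsTopPair x y) (h' : R.IsTopPair u v) : ({u, v} : Set A) = {x, y} := by
  have hu := h.mem_of_isTopPair hxy h'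
  have hv := h.mem_of_isTopPair hxy h'.comm
  rcases hu with rfl | rfl <;> rcases hv with rfl | rfl
  exacts [absurd rfl huv, rfl, Set.pair_comm _ _, absurd rfl huv]

theorem IsTopPair.map {R : Profile N A} {x y : A} (h : R.IsTopPair x y) (σ : Equiv.Perm A) :
    (R.map σ).IsTopPair (σ x) (σ y) := by
  intro z hx hy i
  have := h (σ.symm z) (by rwa [Ne, Equiv.symm_apply_eq]) (by rwa [Ne, Equiv.symm_apply_eq]) i
  simpa [Profile.map, WeakOrd.map_strict] using this

theorem IsTopPair.C5_eq [Nonempty N] {R : Profile N A} {x y : A} (h : R.IsTopPair x y)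
    (hxy : x ≠ y) : C5 R = {x, y}ᶜ := by
  have hex : ∃ p : A × A, p.1 ≠ p.2 ∧ R = R.topShift p.1 p.2 :=
    ⟨(x, y), hxy, (R.eq_topShift_iff x y).2 h⟩
  rw [C5, dif_pos hex]
  have hs := hex.choose_spec
  rw [h.pair_eq hxy hs.1 ((R.eq_topShift_iff _ _).1 hs.2)]

theorem notMem_C5_topShift [Nonempty N] (R : Profile N A) {x y : A} (hxy : x ≠ y) :
    x ∉ C5 (R.topShift x y) := by
  simp [(R.isTopPair_topShift x y).C5_eq hxy]

end Profile

section C5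

variable {N A : Type*}

theorem C5_nonempty [Fintype A] (hA : 3 ≤ Fintype.card A) (R : Profile N A) :
    (C5 R).Nonempty := by
  classical
  have compl_pair (x y : A) : (({x, y} : Set A)ᶜ).Nonempty := by
    obtain ⟨z, hz⟩ : (({x, y} : Finset A)ᶜ).Nonempty := by
      rw [← Finset.card_pos, Finset.card_compl]
      have := Finset.card_le_two (a := x) (b := y)
      omega
    exact ⟨z, by simpa using hz⟩
  rw [C5]
  split_ifs
  · exact compl_pair _ _
  · obtain ⟨a⟩ : Nonempty A := Fintype.card_pos_iff.1 (by omega)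
    exact ⟨a, Set.mem_univ a⟩

theorem C5_topConsistency [Nonempty N] [Nontrivial A] :
    TopConsistency (C5 (N := N) (A := A)) := by
  rintro R ⟨x, hx⟩
  obtain ⟨y, hy⟩ := exists_ne x
  exact absurd (hx y hy) (R.notMem_C5_topShift hy.symm)

theorem C5_topAnonymity [Nonempty N] : TopAnonymity (C5 (N := N) (A := A)) := by
  rintro R ⟨x, y, hxy, h⟩ π
  have h' : Profile.IsTopPair (fun i => R (π i)) x y := fun z hx hy i => h z hx hy (π i)
  rw [h'.C5_eq hxy, Profile.IsTopPair.C5_eq h hxy]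

theorem C5_topNeutrality [Nonempty N] : TopNeutrality (C5 (N := N) (A := A)) := by
  rintro R ⟨x, y, hxy, h⟩ σ
  have h : R.IsTopPair x y := h
  rw [(h.map σ).C5_eq (σ.injective.ne hxy), h.C5_eq hxy,
    Set.image_compl_eq σ.bijective, Set.image_pair]

theorem C5_topMonotonicity [Nonempty N] : TopMonotonicity (C5 (N := N) (A := A)) :=
  fun R _ _ _ _ hxy _ hx _ => absurd hx (R.notMem_C5_topShift hxy)

theorem not_C5_condorcetConsistent [Nonempty N] [Nontrivial A] :
    ¬ CondorcetConsistent (C5 (N := N) (A := A)) := by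
  obtain ⟨x, y, hxy⟩ := exists_pair_ne A
  let I : Profile N A := fun _ => ⟨fun _ _ => True, by simp, by simp⟩
  have hx : x ∈ CW (I.topShift x y) := by
    intro z hz
    have : IsEmpty {i // (I.topShift x y i).strict z x} :=
      ⟨fun ⟨i, hi⟩ => hi.2 (by simp [I, Profile.topShift, WeakOrd.topShift])⟩
    rw [nwins, Nat.card_of_isEmpty]
    exact Nat.zero_le _
  intro hC
  exact I.notMem_C5_topShift hxy (hC _ ⟨x, hx⟩ ▸ hx)

end C5

/-- TR cannot be dropped: `C₅` is an SDR satisfying TC, TA, TN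
and TM but it is not Condorcet-consistent. -/
theorem stmt_12 {N A : Type*} [Fintype N] [Fintype A]
    (hN : 2 ≤ Fintype.card N) (hA : 3 ≤ Fintype.card A) :
    (∀ R : Profile N A, (C5 R).Nonempty) ∧
    TopConsistency (C5 (N := N) (A := A)) ∧
    TopAnonymity (C5 (N := N) (A := A)) ∧
    TopNeutrality (C5 (N := N) (A := A)) ∧
    TopMonotonicity (C5 (N := N) (A := A)) ∧
    ¬ CondorcetConsistent (C5 (N := N) (A := A)) := by
  have : Nonempty N := Fintype.card_pos_iff.1 (by omega)
  have : Nontrivial A := Fintype.one_lt_card_iff_nontrivial.1 (by omega)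
  exact ⟨C5_nonempty hA, C5_topConsistency, C5_topAnonymity, C5_topNeutrality,
    C5_topMonotonicity, not_C5_condorcetConsistent⟩
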